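/- For all n, m ≥ 3, the class of all finite structures (X, <, E₁, E₂), where < is a strict linear order, E₁ is a graph relation containing no clique of size n (no n pairwise E₁-adjacent vertices), and E₂ is a graph relation containing no clique of size m, has the Ramsey property: for all A, B in this class and all r ∈ ℕ there exists C in this class such that for every coloring χ : Emb(A,C) → Fin r there is g ∈ Emb(B,C) with χ constant on {g ∘ f : f ∈ Emb(A,B)}. -/

import Mathlib

/-- A relational structure with binary relations indexed by `ι`. -/
structure BinStr (ι : Type) : Type 1 where
  carrier : Type
  rel : ι → carrier → carrier → Prop

/-- An embedding of such structures: an injective map that preserves and reflects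
each of the relations. -/
structure BinEmb {ι : Type} (A B : BinStr ι) : Type where
  toFun : A.carrier → B.carrier
  inj : Function.Injective toFun
  map_rel : ∀ (i : ι) (x y : A.carrier), A.rel i x y ↔ B.rel i (toFun x) (toFun y)

/-- Composition of embeddings. -/
def BinEmb.comp {ι : Type} {A B C : BinStr ι} (g : BinEmb B C) (f : BinEmb A B) :
    BinEmb A C where
  toFun := g.toFun ∘ f.toFun
  inj := g.inj.comp f.inj
  map_rel i x y := (f.map_rel i x y).trans (g.map_rel i (f.toFun x) (f.toFun y))

/-- The Ramsey property for a class of structures: for all `A, B` in the class and all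
`r : ℕ` there is `C` in the class such that every colouring of the embeddings of `A` into `C`
with `r` colours is constant on the copies of `A` inside some copy of `B` in `C`. -/
def BinRamseyClass {ι : Type} (K : Set (BinStr ι)) : Prop :=
  ∀ A ∈ K, ∀ B ∈ K, ∀ r : ℕ, ∃ C ∈ K,
    ∀ χ : BinEmb A C → Fin r, ∃ g : BinEmb B C,
      ∀ f₁ f₂ : BinEmb A B, χ (g.comp f₁) = χ (g.comp f₂)

/-- A binary relation `E` on `X` contains a clique of size `n` if there are `n` pairwise
related, pairwise distinct vertices; it is `Kₙ`-free if it contains no such clique. -/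
def BinCliqueFree {X : Type} (E : X → X → Prop) (n : ℕ) : Prop :=
  ¬ ∃ f : Fin n → X, Function.Injective f ∧ ∀ i j : Fin n, i ≠ j → E (f i) (f j)

/-- Finite Ramsey theorem: every colouring of the finite subsets of a sufficiently large set of
naturals is constant on the `k`-element subsets of some `b`-element subset. -/
theorem exists_homogeneous_subset (κ : Type) [Finite κ] [Nonempty κ] (k : ℕ) :
    ∀ b : ℕ, ∃ p : ℕ, ∀ X : Finset ℕ, p ≤ X.card → ∀ c : Finset ℕ → κ,
      ∃ H ⊆ X, H.card = b ∧ ∃ d : κ, ∀ S ⊆ H, S.card = k → c S = d := by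
  classical
  induction k with
  | zero =>
    intro b
    refine ⟨b, fun X hX c => ?_⟩
    obtain ⟨H, hHX, hH⟩ := Finset.exists_subset_card_eq hX
    refine ⟨H, hHX, hH, c ∅, fun S _ hS => ?_⟩
    rw [Finset.card_eq_zero.mp hS]
  | succ k ih =>
    have endHom : ∀ t : ℕ, ∃ p : ℕ, ∀ X : Finset ℕ, p ≤ X.card → ∀ c : Finset ℕ → κ,
        ∃ H ⊆ X, H.card = t ∧ ∃ d : ℕ → κ, ∀ x ∈ H, ∀ S ⊆ H, (∀ y ∈ S, x < y) →
          S.card = k → c (insert x S) = d x := by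
      intro t
      induction t with
      | zero =>
        refine ⟨0, fun X _ c => ⟨∅, by simp, rfl, fun _ => Classical.arbitrary κ, by simp⟩⟩
      | succ t iht =>
        obtain ⟨q, hq⟩ := iht
        obtain ⟨p, hp⟩ := ih q
        refine ⟨p + 1, fun X hX c => ?_⟩
        have hne : X.Nonempty := Finset.card_pos.mp (by omega)
        set m := X.min' hne with hm
        have hmX : m ∈ X := X.min'_mem hne
        obtain ⟨Y, hYX, hY, d₀, hd₀⟩ := hp (X.erase m)
          (by rw [Finset.card_erase_of_mem hmX]; omega) (fun S => c (insert m S))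
        obtain ⟨H, hHY, hH, d, hd⟩ := hq Y hY.ge c
        have hlt : ∀ y ∈ H, m < y := fun y hy =>
          X.min'_lt_of_mem_erase_min' hne (hYX (hHY hy))
        have hmH : m ∉ H := fun h => lt_irrefl _ (hlt m h)
        refine ⟨insert m H, ?_, by rw [Finset.card_insert_of_notMem hmH, hH],
          Function.update d m d₀, ?_⟩
        · exact Finset.insert_subset hmX
            ((hHY.trans hYX).trans (Finset.erase_subset _ _))
        · intro x hx S hS hxS hSk
          have hmS : m ∉ S := by
            intro h
            rcases Finset.mem_insert.mp hx with rfl | hx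
            · exact lt_irrefl _ (hxS _ h)
            · exact lt_asymm (hxS m h) (hlt x hx)
          have hSH : S ⊆ H := (Finset.subset_insert_iff_of_notMem hmS).mp hS
          rcases Finset.mem_insert.mp hx with rfl | hx
          · rw [Function.update_self]
            exact hd₀ S (hSH.trans hHY) hSk
          · rw [Function.update_of_ne (hlt x hx).ne']
            exact hd x hx S hSH hxS hSk
    intro b
    have := Fintype.ofFinite κ
    obtain ⟨p, hp⟩ := endHom (Fintype.card κ * b)
    refine ⟨p, fun X hX c => ?_⟩
    obtain ⟨H, hHX, hH, d, hd⟩ := hp X hX c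
    obtain ⟨d₀, -, hd₀⟩ := Finset.exists_le_card_fiber_of_mul_le_card_of_maps_to
      (s := H) (t := Finset.univ) (f := d) (n := b) (fun _ _ => Finset.mem_univ _)
      Finset.univ_nonempty (by rw [hH, Finset.card_univ])
    obtain ⟨G, hG, hGb⟩ := Finset.exists_subset_card_eq hd₀
    refine ⟨G, (hG.trans (Finset.filter_subset _ _)).trans hHX, hGb, d₀, fun S hS hSk => ?_⟩
    have hne : S.Nonempty := Finset.card_pos.mp (by omega)
    have hmS := S.min'_mem hne
    have hSH : S ⊆ H := (hS.trans hG).trans (Finset.filter_subset _ _)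
    have h := hd _ (hSH hmS) (S.erase (S.min' hne)) ((Finset.erase_subset _ _).trans hSH)
      (fun y hy => S.min'_lt_of_mem_erase_min' hne hy)
      (by rw [Finset.card_erase_of_mem hmS]; omega)
    rw [Finset.insert_erase hmS] at h
    rw [h]
    exact (Finset.mem_filter.mp (hG (hS hmS))).2

/-- A finite graph system over `(V, R)`: symmetric relations `rel j`, where `rel j` has no clique
of size `n j` and `proj` is a homomorphism to `(V, R)`. -/
structure PartiteSystem {J V : Type} (R : J → V → V → Prop) (n : J → ℕ) : Type 1 where
  carrier : Type
  finite : Finite carrier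
  proj : carrier → V
  rel : J → carrier → carrier → Prop
  symm : ∀ j x y, rel j x y → rel j y x
  hom : ∀ j x y, rel j x y → R j (proj x) (proj y)
  cliqueFree : ∀ j, BinCliqueFree (rel j) (n j)

namespace PartiteSystem

variable {J V A : Type} {R : J → V → V → Prop} {n : J → ℕ} {RA : J → A → A → Prop} {s : A → V}

/-- An embedding of partite systems that commutes with the projections. -/
structure Emb (P Q : PartiteSystem R n) : Type where
  toFun : P.carrier → Q.carrier
  inj : Function.Injective toFun
  proj_eq : ∀ x, Q.proj (toFun x) = P.proj x
  rel_iff : ∀ j x y, P.rel j x y ↔ Q.rel j (toFun x) (toFun y)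

/-- A copy of `(A, RA)` in a partite system lying over the map `s : A → V`. -/
@[ext]
structure Copy (RA : J → A → A → Prop) (s : A → V) (P : PartiteSystem R n) : Type where
  toFun : A → P.carrier
  proj_eq : ∀ a, P.proj (toFun a) = s a
  rel_iff : ∀ j a b, RA j a b ↔ P.rel j (toFun a) (toFun b)

/-- The image of a copy under an embedding of partite systems. -/
def Copy.map {P Q : PartiteSystem R n} (f : Copy RA s P) (φ : Emb P Q) : Copy RA s Q where
  toFun a := φ.toFun (f.toFun a)
  proj_eq a := (φ.proj_eq _).trans (f.proj_eq a)
  rel_iff j a b := (f.rel_iff j a b).trans (φ.rel_iff j _ _)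

/-- The identity embedding. -/
def Emb.id (P : PartiteSystem R n) : Emb P P where
  toFun x := x
  inj := Function.injective_id
  proj_eq _ := rfl
  rel_iff _ _ _ := Iff.rfl

/-- Composition of embeddings. -/
def Emb.comp {P Q S : PartiteSystem R n} (ψ : Emb Q S) (φ : Emb P Q) : Emb P S where
  toFun := ψ.toFun ∘ φ.toFun
  inj := ψ.inj.comp φ.inj
  proj_eq x := (ψ.proj_eq _).trans (φ.proj_eq x)
  rel_iff j x y := (φ.rel_iff j x y).trans (ψ.rel_iff j _ _)

instance (P : PartiteSystem R n) : Finite P.carrier := P.finite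

instance [Finite A] (P : PartiteSystem R n) : Finite (Copy RA s P) :=
  Finite.of_injective Copy.toFun fun _ _ h => Copy.ext h

instance {α ι : Type} [Finite α] [Finite ι] : Finite (Combinatorics.Line α ι) :=
  Finite.of_injective Combinatorics.Line.idxFun fun l l' h => by
    cases l; cases l'; cases h; rfl

section LineMap

variable (P : PartiteSystem R n) {ι : Type}

/-- The vertices of the power construction: a vertex of `V` together with either a word in `P`
or a vertex of the copy of `P` attached to a combinatorial line of copies. -/
abbrev PowerCarrier (RA : J → A → A → Prop) (s : A → V) (ι : Type) : Type :=
  V × ((ι → P.carrier) ⊕ (Combinatorics.Line (Copy RA s P) ι × P.carrier))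

open Classical in
/-- The copy of `P` in the power construction determined by a combinatorial line: vertices over
the range of `s` are shared between lines, all others are private to the line. -/
noncomputable def lineMap (l : Combinatorics.Line (Copy RA s P) ι) (x : P.carrier) :
    P.PowerCarrier RA s ι :=
  (P.proj x,
    if h : ∃ a, s a = P.proj x then
      Sum.inl fun i => (l.idxFun i).elim x fun β => β.toFun h.choose
    else Sum.inr (l, x))

variable {P}

theorem lineMap_of_eq (hs : Function.Injective s) (l : Combinatorics.Line (Copy RA s P) ι)
    {x : P.carrier} {a : A} (h : s a = P.proj x) :
    P.lineMap l x = (P.proj x, Sum.inl fun i => (l.idxFun i).elim x fun β => β.toFun a) := by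
  have hex : ∃ a, s a = P.proj x := ⟨a, h⟩
  have : hex.choose = a := hs (hex.choose_spec.trans h.symm)
  simp only [lineMap, dif_pos hex, this]

theorem lineMap_of_notMem (l : Combinatorics.Line (Copy RA s P) ι)
    {x : P.carrier} (h : ¬ ∃ a, s a = P.proj x) :
    P.lineMap l x = (P.proj x, Sum.inr (l, x)) := by
  simp only [lineMap, dif_neg h]

theorem proj_eq_of_lineMap_eq {l l' : Combinatorics.Line (Copy RA s P) ι} {x x' : P.carrier}
    (h : P.lineMap l x = P.lineMap l' x') : P.proj x = P.proj x' :=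
  congrArg Prod.fst h

theorem eq_of_lineMap_eq {l l' : Combinatorics.Line (Copy RA s P) ι} {x x' : P.carrier}
    (hx : ¬ ∃ a, s a = P.proj x) (h : P.lineMap l x = P.lineMap l' x') : l = l' ∧ x = x' := by
  have hx' : ¬ ∃ a, s a = P.proj x' := proj_eq_of_lineMap_eq h ▸ hx
  rw [lineMap_of_notMem l hx, lineMap_of_notMem l' hx'] at h
  simpa using (Prod.ext_iff.mp h).2

theorem coord_eq_of_lineMap_eq (hs : Function.Injective s)
    {l l' : Combinatorics.Line (Copy RA s P) ι} {x x' : P.carrier} {a : A}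
    (ha : s a = P.proj x) (h : P.lineMap l x = P.lineMap l' x') (i : ι) :
    ((l.idxFun i).elim x fun β => β.toFun a) = (l'.idxFun i).elim x' fun β => β.toFun a := by
  have ha' := ha.trans (proj_eq_of_lineMap_eq h)
  rw [lineMap_of_eq hs l ha, lineMap_of_eq hs l' ha'] at h
  exact congrFun (Sum.inl.inj (Prod.ext_iff.mp h).2) i

theorem lineMap_injective (hs : Function.Injective s)
    (l : Combinatorics.Line (Copy RA s P) ι) : Function.Injective (P.lineMap l) := by
  intro x y h
  by_cases hx : ∃ a, s a = P.proj x
  · obtain ⟨a, ha⟩ := hx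
    obtain ⟨i, hi⟩ := l.proper
    simpa [hi] using coord_eq_of_lineMap_eq hs ha h i
  · exact (eq_of_lineMap_eq hx h).2

theorem rel_of_lineMap_eq (hs : Function.Injective s) {j : J}
    {l l' : Combinatorics.Line (Copy RA s P) ι} {x x' y y' : P.carrier}
    (hx : P.lineMap l x = P.lineMap l' x') (hy : P.lineMap l y = P.lineMap l' y')
    (h : P.rel j x' y') : P.rel j x y := by
  by_cases hxs : ∃ a, s a = P.proj x
  swap
  · obtain ⟨rfl, rfl⟩ := eq_of_lineMap_eq hxs hx
    rwa [lineMap_injective hs l hy]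
  by_cases hys : ∃ a, s a = P.proj y
  swap
  · obtain ⟨rfl, rfl⟩ := eq_of_lineMap_eq hys hy
    rwa [lineMap_injective hs l hx]
  obtain ⟨a, ha⟩ := hxs
  obtain ⟨b, hb⟩ := hys
  have cx := coord_eq_of_lineMap_eq hs ha hx
  have cy := coord_eq_of_lineMap_eq hs hb hy
  obtain ⟨i, hi⟩ := l.proper
  obtain ⟨i', hi'⟩ := l'.proper
  have cxi := cx i
  have cyi := cy i
  have cxi' := cx i'
  have cyi' := cy i'
  simp only [hi, Option.elim_none] at cxi cyi
  simp only [hi', Option.elim_none] at cxi' cyi'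
  rcases hl' : l'.idxFun i with _ | α
  · simp only [hl', Option.elim_none] at cxi cyi
    rwa [cxi, cyi]
  rcases hl : l.idxFun i' with _ | α'
  · simp only [hl, Option.elim_none] at cxi' cyi'
    rwa [cxi', cyi']
  simp only [hl', Option.elim_some] at cxi cyi
  simp only [hl, Option.elim_some] at cxi' cyi'
  rw [cxi, cyi, ← α.rel_iff, α'.rel_iff, cxi', cyi']
  exact h

end LineMap

section Power

variable (P : PartiteSystem R n) [Finite V] [Finite A] (RA) (s) (ι : Type) [Finite ι]

/-- The power construction: the union of the copies of `P` attached to all combinatorial lines in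
the space of words whose letters are the copies of `A` in `P` over `s`. -/
noncomputable def power (hs : Function.Injective s) (hR : ∀ j v, ¬ R j v v) (hn : ∀ j, 2 ≤ n j)
    (hclique : ∀ j, ¬ ∃ f : Fin (n j) → A, ∀ i k, i ≠ k → R j (s (f i)) (s (f k))) :
    PartiteSystem R n where
  carrier := P.PowerCarrier RA s ι
  finite := inferInstance
  proj := Prod.fst
  rel j p q := ∃ (l : Combinatorics.Line (Copy RA s P) ι) (x y : P.carrier),
    P.rel j x y ∧ P.lineMap l x = p ∧ P.lineMap l y = q
  symm := by
    rintro j _ _ ⟨l, x, y, h, hx, hy⟩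
    exact ⟨l, y, x, P.symm j x y h, hy, hx⟩
  hom := by
    rintro _ _ _ ⟨l, x, y, h, rfl, rfl⟩
    exact P.hom _ x y h
  cliqueFree := by
    rintro j ⟨f, -, hf⟩
    by_cases hall : ∀ i, ∃ a, s a = (f i).1
    · choose a ha using hall
      refine hclique j ⟨a, fun i k hik => ?_⟩
      obtain ⟨l, x, y, h, hx, hy⟩ := hf i k hik
      rw [ha, ha, ← hx, ← hy]
      exact P.hom j x y h
    · push Not at hall
      obtain ⟨i, hi⟩ := hall
      have hi' : ¬ ∃ a, s a = (f i).1 := fun ⟨a, ha⟩ => hi a ha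
      have : Nontrivial (Fin (n j)) := Fin.nontrivial_iff_two_le.mpr (hn j)
      obtain ⟨k, hk⟩ := exists_ne i
      obtain ⟨l, x, y, -, hx, -⟩ := hf i k hk.symm
      have hxs : ¬ ∃ a, s a = P.proj x := by rwa [← hx] at hi'
      have hrange : ∀ k, ∃ z, P.lineMap l z = f k := by
        intro k
        by_cases hki : k = i
        · exact ⟨x, by rw [hx, hki]⟩
        obtain ⟨l', x', y', -, hx', hy'⟩ := hf i k (Ne.symm hki)
        obtain ⟨rfl, -⟩ := eq_of_lineMap_eq hxs (hx.trans hx'.symm)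
        exact ⟨y', hy'⟩
      choose z hz using hrange
      have hzrel : ∀ k k', k ≠ k' → P.rel j (z k) (z k') := by
        intro k k' hkk'
        obtain ⟨l', x', y', h, hx', hy'⟩ := hf k k' hkk'
        exact rel_of_lineMap_eq hs ((hz k).trans hx'.symm) ((hz k').trans hy'.symm) h
      refine P.cliqueFree j ⟨z, fun k k' hkk' => ?_, hzrel⟩
      by_contra hne
      have := P.hom j _ _ (hzrel k k' hne)
      rw [hkk'] at this
      exact hR j _ this

variable {RA} {s} {ι} {P} (hs : Function.Injective s) (hR : ∀ j v, ¬ R j v v) (hn : ∀ j, 2 ≤ n j)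
    (hclique : ∀ j, ¬ ∃ f : Fin (n j) → A, ∀ i k, i ≠ k → R j (s (f i)) (s (f k)))

/-- The embedding of `P` into its power determined by a combinatorial line. -/
noncomputable def lineEmb (l : Combinatorics.Line (Copy RA s P) ι) :
    Emb P (P.power RA s ι hs hR hn hclique) where
  toFun := P.lineMap l
  inj := lineMap_injective hs l
  proj_eq _ := rfl
  rel_iff _ x y := ⟨fun h => ⟨l, x, y, h, rfl, rfl⟩,
    fun ⟨_, _, _, h, hx, hy⟩ => rel_of_lineMap_eq hs hx.symm hy.symm h⟩

open Classical in
/-- The copy of `A` in the power of `P` given by a word of copies of `A` in `P`. -/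
noncomputable def wordCopy [Nonempty ι] (w : ι → Copy RA s P) :
    Copy RA s (P.power RA s ι hs hR hn hclique) where
  toFun a := (s a, Sum.inl fun i => (w i).toFun a)
  proj_eq _ := rfl
  rel_iff j a b := by
    constructor
    · intro h
      obtain ⟨i₀⟩ := ‹Nonempty ι›
      let l : Combinatorics.Line (Copy RA s P) ι :=
        ⟨fun i => if i = i₀ then none else some (w i), i₀, if_pos rfl⟩
      have key : ∀ c, P.lineMap l ((w i₀).toFun c) = (s c, Sum.inl fun i => (w i).toFun c) := by
        intro c
        rw [lineMap_of_eq hs l ((w i₀).proj_eq c).symm, (w i₀).proj_eq]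
        refine congrArg (fun u => (s c, Sum.inl u)) (funext fun i => ?_)
        by_cases hi : i = i₀
        · simp [l, hi]
        · simp [l, hi]
      exact ⟨l, _, _, ((w i₀).rel_iff j a b).mp h, key a, key b⟩
    · rintro ⟨l, x, y, h, hx, hy⟩
      have hxs : s a = P.proj x := (congrArg Prod.fst hx).symm
      have hys : s b = P.proj y := (congrArg Prod.fst hy).symm
      obtain ⟨i, hi⟩ := l.proper
      rw [lineMap_of_eq hs l hxs] at hx
      rw [lineMap_of_eq hs l hys] at hy
      have hxi := congrFun (Sum.inl.inj (Prod.ext_iff.mp hx).2) i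
      have hyi := congrFun (Sum.inl.inj (Prod.ext_iff.mp hy).2) i
      simp only [hi, Option.elim_none] at hxi hyi
      rwa [(w i).rel_iff, ← hxi, ← hyi]

theorem map_lineEmb [Nonempty ι] (l : Combinatorics.Line (Copy RA s P) ι) (f : Copy RA s P) :
    f.map (lineEmb hs hR hn hclique l) = wordCopy hs hR hn hclique (l f) := by
  ext a
  change P.lineMap l (f.toFun a) = (s a, Sum.inl fun i => (l f i).toFun a)
  rw [lineMap_of_eq hs l (f.proj_eq a).symm, f.proj_eq]
  refine congrArg (fun u => (s a, Sum.inl u)) (funext fun i => ?_)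
  rw [Combinatorics.Line.apply_def]
  rcases hl : l.idxFun i with _ | β <;> simp [hl]


end Power

section Ramsey

variable [Finite V] [Finite A] (P : PartiteSystem R n) (κ : Type) [Finite κ] [Nonempty κ]

/-- Partite lemma: every colouring of the copies of `A` over `s` in a suitable extension of `P` is
constant on the copies of `A` over `s` inside some copy of `P`. -/
theorem exists_emb_const_of_position (RA : J → A → A → Prop) (s : A → V)
    (hs : Function.Injective s) (hR : ∀ j v, ¬ R j v v) (hn : ∀ j, 2 ≤ n j)
    (hclique : ∀ j, ¬ ∃ f : Fin (n j) → A, ∀ i k, i ≠ k → R j (s (f i)) (s (f k))) :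
    ∃ Q : PartiteSystem R n, ∀ χ : Copy RA s Q → κ, ∃ φ : Emb P Q,
      ∀ f₁ f₂ : Copy RA s P, χ (f₁.map φ) = χ (f₂.map φ) := by
  obtain ⟨ι, _, hι⟩ :=
    Combinatorics.Line.exists_mono_in_high_dimension (Copy RA s P) κ
  obtain ⟨l₀, -⟩ := hι fun _ => Classical.arbitrary κ
  have : Nonempty ι := ⟨l₀.proper.choose⟩
  refine ⟨P.power RA s ι hs hR hn hclique, fun χ => ?_⟩
  obtain ⟨l, c, hl⟩ := hι fun w => χ (wordCopy hs hR hn hclique w)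
  refine ⟨lineEmb hs hR hn hclique l, fun f₁ f₂ => ?_⟩
  rw [map_lineEmb, map_lineEmb]
  exact (hl f₁).trans (hl f₂).symm

/-- Partite construction: for every list `L` of positions, some extension of `P` is such that for
every colouring of copies of `A` some copy of `P` has the property that the colour of the copies
of `A` over a position in `L` depends only on the position. -/
theorem exists_emb_const_of_list (RA : J → A → A → Prop)
    (hR : ∀ j v, ¬ R j v v) (hn : ∀ j, 2 ≤ n j) (L : List (A → V))
    (hL : ∀ s ∈ L, Function.Injective s ∧
      ∀ j, ¬ ∃ f : Fin (n j) → A, ∀ i k, i ≠ k → R j (s (f i)) (s (f k))) :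
    ∃ Q : PartiteSystem R n, ∀ χ : (∀ s, Copy RA s Q → κ), ∃ φ : Emb P Q,
      ∀ s ∈ L, ∀ f₁ f₂ : Copy RA s P, χ s (f₁.map φ) = χ s (f₂.map φ) := by
  induction L generalizing P with
  | nil => exact ⟨P, fun _ => ⟨Emb.id P, by simp⟩⟩
  | cons s L ih =>
    obtain ⟨hs, hclique⟩ := hL s List.mem_cons_self
    obtain ⟨P', hP'⟩ := P.exists_emb_const_of_position κ RA s hs hR hn hclique
    obtain ⟨Q, hQ⟩ := ih P' fun t ht => hL t (List.mem_cons_of_mem s ht)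
    refine ⟨Q, fun χ => ?_⟩
    obtain ⟨ψ, hψ⟩ := hQ χ
    obtain ⟨φ, hφ⟩ := hP' fun f => χ s (f.map ψ)
    refine ⟨ψ.comp φ, fun t ht f₁ f₂ => ?_⟩
    rcases List.mem_cons.mp ht with rfl | ht
    · exact hφ f₁ f₂
    · exact hψ t ht (f₁.map φ) (f₂.map φ)

end Ramsey
/-- The disjoint union of copies of a clique-free graph system `(B, RB)`, one over each map `e i`. -/
def sigma {B I : Type} [Finite B] [Finite I] (RB : J → B → B → Prop) (e : I → B → V)
    (hsymm : ∀ j x y, RB j x y → RB j y x) (hfree : ∀ j, BinCliqueFree (RB j) (n j))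
    (hom : ∀ i j x y, RB j x y → R j (e i x) (e i y)) :
    PartiteSystem R n where
  carrier := I × B
  finite := inferInstance
  proj p := e p.1 p.2
  rel j p q := p.1 = q.1 ∧ RB j p.2 q.2
  symm j p q h := ⟨h.1.symm, hsymm j _ _ h.2⟩
  hom := by
    rintro j ⟨i, x⟩ ⟨i', y⟩ ⟨h, hxy⟩
    obtain rfl : i = i' := h
    exact hom i j x y hxy
  cliqueFree := by
    rintro j ⟨f, hf, hrel⟩
    refine hfree j ⟨fun k => (f k).2, fun k k' hkk' => ?_, fun k k' h => (hrel k k' h).2⟩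
    by_contra hne
    exact hne (hf (Prod.ext (hrel k k' hne).1 hkk'))

end PartiteSystem

/-- The class of finite linearly ordered sets with two graph relations, the `j`-th of which has no
clique of size `n j`. -/
def OrderedCliqueFree (n : Fin 2 → ℕ) : Set (BinStr (Fin 3)) :=
  {A | Finite A.carrier ∧ IsStrictTotalOrder A.carrier (A.rel 0) ∧
    ∀ j : Fin 2, (∀ x y, A.rel j.succ x y → A.rel j.succ y x) ∧ (∀ x, ¬ A.rel j.succ x x) ∧
      BinCliqueFree (A.rel j.succ) (n j)}

theorem injective_of_strictMono {X Y : Type} {r : X → X → Prop} {t : Y → Y → Prop}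
    [IsStrictTotalOrder X r] [IsStrictTotalOrder Y t] {f : X → Y}
    (hf : ∀ x y, r x y → t (f x) (f y)) : Function.Injective f := by
  intro x y h
  rcases trichotomous_of r x y with hr | hr | hr
  · exact absurd (h ▸ hf x y hr) (irrefl_of t _)
  · exact hr
  · exact absurd (h ▸ hf y x hr) (irrefl_of t _)

theorem rel_iff_of_strictMono {X Y : Type} {r : X → X → Prop} {t : Y → Y → Prop}
    [IsStrictTotalOrder X r] [IsStrictTotalOrder Y t] {f : X → Y}
    (hf : ∀ x y, r x y → t (f x) (f y)) (x y : X) : r x y ↔ t (f x) (f y) := by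
  refine ⟨hf x y, fun h => ?_⟩
  rcases trichotomous_of r x y with hr | hr | hr
  · exact hr
  · exact absurd (hr ▸ h) (irrefl_of t _)
  · exact absurd (hf y x hr) (asymm_of t h)

/-- The lexicographic refinement of the pullback of `lt` along `π`. -/
def pullbackLex {X V : Type} (lt : V → V → Prop) (π : X → V) (x y : X) : Prop :=
  lt (π x) (π y) ∨ π x = π y ∧ WellOrderingRel x y

instance {X V : Type} (lt : V → V → Prop) [IsStrictTotalOrder V lt] (π : X → V) :
    IsStrictTotalOrder X (pullbackLex lt π) where
  trichotomous x y h₁ h₂ := by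
    simp only [pullbackLex, not_or, not_and] at h₁ h₂
    rcases trichotomous_of lt (π x) (π y) with h | h | h
    · exact absurd h h₁.1
    · rcases trichotomous_of WellOrderingRel x y with h' | h' | h'
      · exact absurd h' (h₁.2 h)
      · exact h'
      · exact absurd h' (h₂.2 h.symm)
    · exact absurd h h₂.1
  irrefl x h := h.elim (irrefl_of lt _) fun h => irrefl_of WellOrderingRel x h.2
  trans x y z := by
    rintro (h | ⟨h, h'⟩) (k | ⟨k, k'⟩)
    · exact Or.inl (trans_of lt h k)
    · exact Or.inl (k ▸ h)
    · exact Or.inl (h ▸ k)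
    · exact Or.inr ⟨h.trans k, trans_of WellOrderingRel h' k'⟩

/-- Transfer of the Ramsey property from a base `(V, lt, R)`, which need not be clique-free, to
the clique-free class: it suffices that each colouring of maps `A → V` is constant on the copies of
`A` inside some monotone homomorphic image of `B` in which the copies of `A` span no forbidden
cliques of `R`. -/
theorem exists_ramsey_of_base (κ : Type) [Finite κ] [Nonempty κ] {n : Fin 2 → ℕ}
    (hn : ∀ j, 2 ≤ n j) {A B : BinStr (Fin 3)} [Finite A.carrier]
    [IsStrictTotalOrder A.carrier (A.rel 0)] (hB : B ∈ OrderedCliqueFree n)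
    {V : Type} [Finite V] (lt : V → V → Prop) [IsStrictTotalOrder V lt]
    (R : Fin 2 → V → V → Prop) (hR : ∀ j v, ¬ R j v v)
    (hbase : ∀ c : (A.carrier → V) → κ, ∃ e : B.carrier → V,
      (∀ x y, B.rel 0 x y → lt (e x) (e y)) ∧
      (∀ (j : Fin 2) x y, B.rel j.succ x y → R j (e x) (e y)) ∧
      (∀ (f : BinEmb A B) j, ¬ ∃ k : Fin (n j) → A.carrier, ∀ i i', i ≠ i' →
        R j (e (f.toFun (k i))) (e (f.toFun (k i')))) ∧
      ∀ f₁ f₂ : BinEmb A B, c (e ∘ f₁.toFun) = c (e ∘ f₂.toFun)) :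
    ∃ C ∈ OrderedCliqueFree n, ∀ χ : BinEmb A C → κ, ∃ g : BinEmb B C,
      ∀ f₁ f₂ : BinEmb A B, χ (g.comp f₁) = χ (g.comp f₂) := by
  classical
  obtain ⟨_, _, hBg⟩ := hB
  let I := {e : B.carrier → V // (∀ x y, B.rel 0 x y → lt (e x) (e y)) ∧
    ∀ (j : Fin 2) x y, B.rel j.succ x y → R j (e x) (e y)}
  let P : PartiteSystem R n := PartiteSystem.sigma (I := I) (fun j => B.rel j.succ) (fun e => e.1)
    (fun j => (hBg j).1) (fun j => (hBg j).2.2) fun e => e.2.2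
  let RA : Fin 2 → A.carrier → A.carrier → Prop := fun j => A.rel j.succ
  let T : Set (A.carrier → V) := {s | Function.Injective s ∧
      ∀ j, ¬ ∃ f : Fin (n j) → A.carrier, ∀ i k, i ≠ k → R j (s (f i)) (s (f k))}
  have hT : T.Finite := Set.toFinite T
  obtain ⟨Q, hQ⟩ := P.exists_emb_const_of_list κ RA hR hn hT.toFinset.toList
    fun s hs => by simpa [T] using hs
  let C : BinStr (Fin 3) := ⟨Q.carrier, Fin.cons (pullbackLex lt Q.proj) Q.rel⟩
  have hC : IsStrictTotalOrder C.carrier (C.rel 0) :=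
    inferInstanceAs (IsStrictTotalOrder Q.carrier (pullbackLex lt Q.proj))
  refine ⟨C, ⟨Q.finite, hC, fun j => ⟨Q.symm j, fun x h => hR j _ (Q.hom j x x h),
    Q.cliqueFree j⟩⟩, fun χ => ?_⟩
  let lift (s : A.carrier → V) (hs : ∀ x y, A.rel 0 x y → lt (s x) (s y))
      (f : PartiteSystem.Copy RA s Q) : BinEmb A C :=
    have hf : ∀ x y, A.rel 0 x y → C.rel 0 (f.toFun x) (f.toFun y) := fun x y h =>
      Or.inl (by rw [f.proj_eq, f.proj_eq]; exact hs x y h)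
    { toFun := f.toFun
      inj := injective_of_strictMono hf
      map_rel := Fin.cases (rel_iff_of_strictMono hf) f.rel_iff }
  obtain ⟨φ, hφ⟩ := hQ fun s f =>
    if hs : ∀ x y, A.rel 0 x y → lt (s x) (s y) then χ (lift s hs f) else Classical.arbitrary κ
  obtain ⟨e, he, heR, hclique, hconst⟩ := hbase fun s =>
    if h : (∀ x y, A.rel 0 x y → lt (s x) (s y)) ∧ Nonempty (PartiteSystem.Copy RA s P) then
      χ (lift s h.1 (h.2.some.map φ)) else Classical.arbitrary κ
  let e' : I := ⟨e, he, heR⟩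
  have hg : ∀ x y, B.rel 0 x y → C.rel 0 (φ.toFun (e', x)) (φ.toFun (e', y)) := fun x y h =>
    Or.inl ((congrArg₂ lt (φ.proj_eq (e', x)) (φ.proj_eq (e', y))).mpr (he x y h))
  let g : BinEmb B C :=
    { toFun := fun x => φ.toFun (e', x)
      inj := injective_of_strictMono hg
      map_rel := Fin.cases (rel_iff_of_strictMono hg) fun j x y =>
        Iff.trans ⟨fun h => ⟨rfl, h⟩, fun h => h.2⟩ (φ.rel_iff j (e', x) (e', y)) }
  refine ⟨g, fun f₁ f₂ => ?_⟩
  have key : ∀ f : BinEmb A B, χ (g.comp f) =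
      if h : (∀ x y, A.rel 0 x y → lt ((e ∘ f.toFun) x) ((e ∘ f.toFun) y)) ∧
        Nonempty (PartiteSystem.Copy RA (e ∘ f.toFun) P) then
      χ (lift (e ∘ f.toFun) h.1 (h.2.some.map φ)) else Classical.arbitrary κ := by
    intro f
    have hmono : ∀ x y, A.rel 0 x y → lt ((e ∘ f.toFun) x) ((e ∘ f.toFun) y) := fun x y h =>
      he _ _ ((f.map_rel 0 x y).mp h)
    let k : PartiteSystem.Copy RA (e ∘ f.toFun) P :=
      { toFun := fun a => (e', f.toFun a)
        proj_eq := fun _ => rfl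
        rel_iff := fun j a b => (f.map_rel j.succ a b).trans
          ⟨fun h => ⟨rfl, h⟩, fun h => h.2⟩ }
    have hk : (∀ x y, A.rel 0 x y → lt ((e ∘ f.toFun) x) ((e ∘ f.toFun) y)) ∧
        Nonempty (PartiteSystem.Copy RA (e ∘ f.toFun) P) := ⟨hmono, ⟨k⟩⟩
    have hmem : e ∘ f.toFun ∈ hT.toFinset.toList := by
      rw [Finset.mem_toList, Set.Finite.mem_toFinset]
      exact ⟨injective_of_strictMono hmono, hclique f⟩
    have := hφ _ hmem k hk.2.some
    rw [dif_pos hmono, dif_pos hmono] at this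
    rw [dif_pos hk]
    exact this
  rw [key, key]
  exact hconst f₁ f₂

/-- Ramsey's theorem for strictly monotone maps between finite strict linear orders. -/
theorem exists_strictMono_const (κ : Type) [Finite κ] [Nonempty κ] {X Y : Type} [Finite X]
    [Finite Y] (r : X → X → Prop) [IsStrictTotalOrder X r] (t : Y → Y → Prop)
    [IsStrictTotalOrder Y t] : ∃ p : ℕ, ∀ c : (X → Fin p) → κ, ∃ e : Y → Fin p,
      (∀ x y, t x y → e x < e y) ∧ ∀ f₁ f₂ : X → Y, (∀ x y, r x y → t (f₁ x) (f₁ y)) →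
        (∀ x y, r x y → t (f₂ x) (f₂ y)) → c (e ∘ f₁) = c (e ∘ f₂) := by
  classical
  let := linearOrderOfSTO r
  let := linearOrderOfSTO t
  have := Fintype.ofFinite X
  have := Fintype.ofFinite Y
  obtain ⟨p, hp⟩ := exists_homogeneous_subset κ (Fintype.card X) (Fintype.card Y)
  refine ⟨p, fun c => ?_⟩
  have huniq : ∀ s₁ s₂ : X → Fin p, StrictMono s₁ → StrictMono s₂ →
      Finset.univ.image (fun x => (s₁ x : ℕ)) = Finset.univ.image (fun x => (s₂ x : ℕ)) →
      s₁ = s₂ := by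
    intro s₁ s₂ h₁ h₂ h
    refine (h₁.range_inj h₂).mp ?_
    ext i
    have := Finset.ext_iff.mp h i
    simpa [Fin.val_inj] using this
  obtain ⟨H, hHp, hH, d, hd⟩ := hp (Finset.range p) (by simp) fun S =>
    if h : ∃ s : X → Fin p, StrictMono s ∧ Finset.univ.image (fun x => (s x : ℕ)) = S then
      c h.choose else Classical.arbitrary κ
  let e₀ : Y ≃o H := (Fintype.orderIsoFinOfCardEq Y rfl).symm.trans (H.orderIsoOfFin hH)
  let e : Y → Fin p := fun y => ⟨e₀ y, Finset.mem_range.mp (hHp (e₀ y).2)⟩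
  have he : StrictMono e := fun x y h => e₀.strictMono h
  refine ⟨e, fun x y h => he h, ?_⟩
  have key : ∀ f : X → Y, (∀ x y, r x y → t (f x) (f y)) → c (e ∘ f) = d := by
    intro f hf
    have hf' : StrictMono f := fun x y h => hf x y h
    have hef := he.comp hf'
    have h : ∃ s : X → Fin p, StrictMono s ∧ Finset.univ.image (fun x => (s x : ℕ)) =
        Finset.univ.image (fun x => ((e ∘ f) x : ℕ)) := ⟨e ∘ f, hef, rfl⟩
    have hS := hd (Finset.univ.image (fun x => ((e ∘ f) x : ℕ)))
      (by
        intro z hz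
        obtain ⟨x, -, rfl⟩ := Finset.mem_image.mp hz
        exact (e₀ (f x)).2)
      (Finset.card_image_of_injective _ (Fin.val_injective.comp hef.injective))
    rw [dif_pos h] at hS
    exact (congrArg c (huniq _ _ hef h.choose_spec.1 h.choose_spec.2.symm)).trans hS
  intro f₁ f₂ h₁ h₂
  rw [key f₁ h₁, key f₂ h₂]

/-- The Ramsey property of `OrderedCliqueFree n` for an arbitrary nonempty finite set of colours. -/
theorem exists_ramsey_colors (κ : Type) [Finite κ] [Nonempty κ] {n : Fin 2 → ℕ}
    (hn : ∀ j, 2 ≤ n j) {A B : BinStr (Fin 3)} (hA : A ∈ OrderedCliqueFree n)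
    (hB : B ∈ OrderedCliqueFree n) :
    ∃ C ∈ OrderedCliqueFree n, ∀ χ : BinEmb A C → κ, ∃ g : BinEmb B C,
      ∀ f₁ f₂ : BinEmb A B, χ (g.comp f₁) = χ (g.comp f₂) := by
  classical
  obtain ⟨_, _, hAg⟩ := hA
  have hB' := hB
  obtain ⟨_, _, hBg⟩ := hB'
  obtain ⟨p, hp⟩ := exists_strictMono_const κ (A.rel 0) (B.rel 0)
  have hcard : ∀ {X : Type} [Finite X] {N : ℕ}, Nat.card X < N →
      ¬ ∃ f : Fin N → X, Function.Injective f := by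
    rintro X _ N hN ⟨f, hf⟩
    have := Nat.card_le_card_of_injective f hf
    rw [Nat.card_fin] at this
    omega
  let N : ℕ := Nat.card A.carrier + Nat.card B.carrier + 2
  -- First use an unrestricted base to get a Ramsey structure `D` with possibly large cliques.
  obtain ⟨D, ⟨_, _, hDg⟩, hD⟩ := exists_ramsey_of_base κ (n := fun _ => N) (A := A) (B := B)
    (fun _ => by omega)
    ⟨inferInstance, inferInstance, fun j => ⟨(hBg j).1, (hBg j).2.1, fun ⟨f, hf, _⟩ =>
      hcard (N := N) (by omega) ⟨f, hf⟩⟩⟩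
    (V := Fin p) (· < ·) (fun _ x y => x ≠ y) (fun _ _ h => h rfl) (by
      intro c
      obtain ⟨e, he, hconst⟩ := hp c
      refine ⟨e, he, fun j x y h hxy => ?_, ?_, fun f₁ f₂ => hconst _ _
        (fun x y => (f₁.map_rel 0 x y).mp) (fun x y => (f₂.map_rel 0 x y).mp)⟩
      · exact (hBg j).2.1 x (injective_of_strictMono he hxy ▸ h)
      · rintro f j ⟨k, hk⟩
        refine hcard (N := N) (by omega) ⟨k, fun i i' h => ?_⟩
        by_contra hne
        exact hk i i' hne (by rw [h]))
  refine exists_ramsey_of_base κ hn hB (D.rel 0) (fun j => D.rel j.succ) (fun j => (hDg j).2.1)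
    fun c => ?_
  obtain ⟨g, hg⟩ := hD fun f => c f.toFun
  refine ⟨g.toFun, fun x y => (g.map_rel 0 x y).mp, fun j x y => (g.map_rel j.succ x y).mp,
    ?_, hg⟩
  rintro f j ⟨k, hk⟩
  have hk' : ∀ i i', i ≠ i' → A.rel j.succ (k i) (k i') := fun i i' h =>
    ((g.comp f).map_rel j.succ _ _).mpr (hk i i' h)
  refine (hAg j).2.2 ⟨k, fun i i' h => ?_, hk'⟩
  by_contra hne
  exact (hAg j).2.1 _ (h ▸ hk' i i' hne)

theorem binRamseyClass_orderedCliqueFree {n : Fin 2 → ℕ} (hn : ∀ j, 2 ≤ n j) :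
    BinRamseyClass (OrderedCliqueFree n) := by
  intro A hA B hB r
  obtain ⟨C, hC, h⟩ := exists_ramsey_colors (Fin (r + 1)) hn hA hB
  refine ⟨C, hC, fun χ => ?_⟩
  obtain ⟨g, hg⟩ := h fun f => (χ f).castSucc
  exact ⟨g, fun f₁ f₂ => Fin.castSucc_injective r (hg f₁ f₂)⟩


/-- For all `n, m ≥ 3`, the class of all finite structures `(X, <, E₁, E₂)`, where `<`
(index 0) is a strict linear order, `E₁` (index 1) is a `Kₙ`-free graph relation, and `E₂`
(index 2) is a `Kₘ`-free graph relation, has the Ramsey property. -/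
theorem statement18 :
    ∀ n m : ℕ, 3 ≤ n → 3 ≤ m →
      BinRamseyClass {A : BinStr (Fin 3) |
        Finite A.carrier ∧
          IsStrictTotalOrder A.carrier (A.rel 0) ∧
          (∀ x y : A.carrier, A.rel 1 x y → A.rel 1 y x) ∧
          (∀ x : A.carrier, ¬ A.rel 1 x x) ∧
          BinCliqueFree (A.rel 1) n ∧
          (∀ x y : A.carrier, A.rel 2 x y → A.rel 2 y x) ∧
          (∀ x : A.carrier, ¬ A.rel 2 x x) ∧
          BinCliqueFree (A.rel 2) m} := by
  intro n m hn hm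
  convert binRamseyClass_orderedCliqueFree (n := ![n, m])
    (Fin.forall_fin_two.mpr ⟨by simp; omega, by simp; omega⟩) using 1
  ext A
  simp [OrderedCliqueFree, Fin.forall_fin_two, and_assoc]
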